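/- arXiv:math/0509537 — 2 statements merged into one kernel-verified Lean document; each statement's English description precedes it below -/
import Mathlib

section
/- Let a_1 < a_2 < ... < a_r be real numbers with r ≥ 3, and for i = 2, ..., r-1 set μ_i = (a_i - a_1)/(a_r - a_1). (a) If μ_i is irrational for some i ∈ {2,...,r-1}, then IV(a_1,...,a_r) = ∅. (b) If every μ_i is rational, say μ_i = p_i/q_i with gcd(p_i, q_i) = 1, and M = lcm(q_2, ..., q_{r-1}), then IV(a_1,...,a_r) = { (1/(M·t))·a_1 + (1 - 1/(M·t))·a_r : t ∈ ℕ, t ≥ 1 }. -/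
/-- The average of the first `n` terms of a sequence `x` (terms `x 0, ..., x (n-1)`). -/
noncomputable def avgSeq (x : ℕ → ℝ) (n : ℕ) : ℝ := (∑ i ∈ Finset.range n, x i) / n

/-- `IV A a b` : the set of "intermediate values" `P ∈ (a,b)` such that for every sequence with
terms in `A`, the consecutive averages cannot pass from below `P` to above `P` without hitting `P`
at an intermediate index. -/
def IV (A : Set ℝ) (a b : ℝ) : Set ℝ :=
  {P | P ∈ Set.Ioo a b ∧ ∀ x : ℕ → ℝ, (∀ n, x n ∈ A) →
    ∀ k l : ℕ, 1 ≤ k → k < l → avgSeq x k < P → P < avgSeq x l →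
      ∃ s : ℕ, k < s ∧ s < l ∧ avgSeq x s = P}

theorem avgSeq_eq_iff (x : ℕ → ℝ) {n : ℕ} (hn : 1 ≤ n) (P : ℝ) :
    avgSeq x n = P ↔ ∑ i ∈ Finset.range n, x i = n * P := by
  have h : (0 : ℝ) < n := by exact_mod_cast hn
  rw [avgSeq, div_eq_iff h.ne', mul_comm P]

theorem avgSeq_lt_iff (x : ℕ → ℝ) {n : ℕ} (hn : 1 ≤ n) (P : ℝ) :
    avgSeq x n < P ↔ ∑ i ∈ Finset.range n, x i < n * P := by
  have h : (0 : ℝ) < n := by exact_mod_cast hn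
  rw [avgSeq, div_lt_iff₀ h, mul_comm P]

theorem lt_avgSeq_iff (x : ℕ → ℝ) {n : ℕ} (hn : 1 ≤ n) (P : ℝ) :
    P < avgSeq x n ↔ n * P < ∑ i ∈ Finset.range n, x i := by
  have h : (0 : ℝ) < n := by exact_mod_cast hn
  rw [avgSeq, lt_div_iff₀ h, mul_comm P]

/-- Applying the intermediate value property to the sequence `a, y, b, b, b, …`. -/
theorem exists_nat_mul_sub_of_mem_IV {A : Set ℝ} {a b P y : ℝ} (hP : P ∈ IV A a b)
    (ha : a ∈ A) (hb : b ∈ A) (hy : y ∈ A) : ∃ s : ℕ, s * (b - P) = 2 * b - a - y := by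
  obtain ⟨⟨haP, hPb⟩, h⟩ := hP
  let x : ℕ → ℝ := fun n => if n = 0 then a else if n = 1 then y else b
  have hx : ∀ n, x n ∈ A := by
    intro n
    simp only [x]
    split_ifs <;> assumption
  have hsum : ∀ n : ℕ, ∑ i ∈ Finset.range (n + 2), x i = a + y + n * b := by
    intro n
    induction n with
    | zero => simp [x, Finset.sum_range_succ]
    | succ n ih =>
      rw [show n + 1 + 2 = (n + 2) + 1 by ring, Finset.sum_range_succ, ih]
      simp [x]
      ring
  obtain ⟨m, hm⟩ := exists_nat_gt ((2 * P - a - y) / (b - P))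
  rw [div_lt_iff₀ (sub_pos.2 hPb)] at hm
  obtain ⟨s, hs, -, hs'⟩ := h x hx 1 (m + 2) le_rfl (by omega)
    (by rw [avgSeq_lt_iff x le_rfl]; simpa [x] using haP)
    (by rw [lt_avgSeq_iff x (by omega), hsum]; push_cast; linarith)
  rw [avgSeq_eq_iff x (by omega)] at hs'
  obtain ⟨n, rfl⟩ : ∃ n, s = n + 2 := ⟨s - 2, by omega⟩
  rw [hsum] at hs'
  refine ⟨n + 2, ?_⟩
  push_cast at hs' ⊢
  linarith

/-- An integer sequence that climbs by at most one at each step cannot skip zero. -/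
theorem exists_eq_zero_of_step_le_one {W : ℕ → ℤ} (hW : ∀ n, W (n + 1) ≤ W n + 1) {k l : ℕ}
    (hkl : k < l) (hk : W k < 0) (hl : 0 < W l) : ∃ s, k < s ∧ s < l ∧ W s = 0 := by
  classical
  have hex : ∃ s, k < s ∧ 0 ≤ W s := ⟨l, hkl, hl.le⟩
  obtain ⟨hks, hs⟩ := Nat.find_spec hex
  have hle : Nat.find hex ≤ l := Nat.find_min' hex ⟨hkl, hl.le⟩
  have hmin : ∀ m < Nat.find hex, ¬(k < m ∧ 0 ≤ W m) := fun m hm => Nat.find_min hex hm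
  generalize Nat.find hex = s at hks hs hle hmin
  obtain ⟨m, rfl⟩ : ∃ m, s = m + 1 := ⟨s - 1, by omega⟩
  have hm : W m < 0 := by
    rcases eq_or_ne k m with rfl | hne
    · exact hk
    · by_contra hcon
      exact hmin m (by omega) ⟨by omega, by omega⟩
  have h0 : W (m + 1) = 0 := by have := hW m; omega
  refine ⟨m + 1, hks, lt_of_le_of_ne hle ?_, h0⟩
  rintro rfl
  omega

/-- If `A` lies in the lattice `b - ℕ (b - P)`, then `P` is an intermediate value. -/
theorem mem_IV_of_lattice {A : Set ℝ} {a b P : ℝ} (hP : P ∈ Set.Ioo a b)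
    (hA : ∀ y ∈ A, ∃ z : ℕ, y = b - z * (b - P)) : P ∈ IV A a b := by
  refine ⟨hP, fun x hx k l hk hkl hk' hl' => ?_⟩
  choose z hz using fun n => hA (x n) (hx n)
  have hδ : 0 < b - P := sub_pos.2 hP.2
  let W : ℕ → ℤ := fun n => ∑ i ∈ Finset.range n, (1 - (z i : ℤ))
  have hsum : ∀ n, ∑ i ∈ Finset.range n, x i = n * P + (b - P) * W n := by
    intro n
    induction n with
    | zero => simp [W]
    | succ n ih =>
      have hWn : W (n + 1) = W n + (1 - z n) := Finset.sum_range_succ _ _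
      rw [Finset.sum_range_succ, ih, hWn, hz n]
      push_cast
      ring
  have hstep : ∀ n, W (n + 1) ≤ W n + 1 := by
    intro n
    have hWn : W (n + 1) = W n + (1 - z n) := Finset.sum_range_succ _ _
    omega
  rw [avgSeq_lt_iff x hk, hsum] at hk'
  rw [lt_avgSeq_iff x (by omega), hsum] at hl'
  have hWk : W k < 0 := by
    have : (W k : ℝ) < 0 := by
      by_contra! hcon
      nlinarith [mul_nonneg hδ.le hcon]
    exact_mod_cast this
  have hWl : 0 < W l := by
    have : (0 : ℝ) < W l := (mul_pos_iff_of_pos_left hδ).1 (by linarith)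
    exact_mod_cast this
  obtain ⟨s, hks, hsl, hs⟩ := exists_eq_zero_of_step_le_one hstep hkl hWk hWl
  refine ⟨s, hks, hsl, ?_⟩
  rw [avgSeq_eq_iff x (by omega), hsum, hs]
  simp

/-- An intermediate value `P` divides `(a, b)` in the ratio `N - 1 : 1`, and every point of `A`
is an integer number of `N`-ths of `b - a` away from `b`. -/
theorem exists_denominator_of_mem_IV {A : Set ℝ} {a b P : ℝ} (hP : P ∈ IV A a b)
    (ha : a ∈ A) (hb : b ∈ A) : ∃ N : ℕ, 1 ≤ N ∧ N * (b - P) = b - a ∧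
      ∀ y ∈ A, ∃ z : ℤ, N * ((y - a) / (b - a)) = z := by
  have hab : 0 < b - a := by linarith [hP.1.1, hP.1.2]
  obtain ⟨N, hN⟩ := exists_nat_mul_sub_of_mem_IV hP ha hb hb
  have hN' : N * (b - P) = b - a := by linarith
  refine ⟨N, ?_, hN', fun y hy => ?_⟩
  · rw [Nat.one_le_iff_ne_zero]
    rintro rfl
    simp at hN'
    linarith
  · obtain ⟨s, hs⟩ := exists_nat_mul_sub_of_mem_IV hP ha hb hy
    refine ⟨2 * N - s, ?_⟩
    rw [← mul_div_assoc, div_eq_iff hab.ne']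
    push_cast
    linear_combination (N : ℝ) * hs - (s : ℝ) * hN'

/-- THEOREM 8: let `a_1 < ... < a_r` (`r ≥ 3`), indexed here by `a 0, ..., a (r-1)`, and for
`1 ≤ i ≤ r - 2` set `μ_i = (a_i - a_0)/(a_{r-1} - a_0)`. (a) If some `μ_i` is irrational then
`IV(a_1,...,a_r) = ∅`. (b) If each `μ_i = p_i/q_i` in lowest terms and `M = lcm` of the `q_i`,
then `IV(a_1,...,a_r) = { (1/(M·t))·a_1 + (1 - 1/(M·t))·a_r : t ≥ 1 }`. -/
theorem IV_general (r : ℕ) (hr : 3 ≤ r) (a : ℕ → ℝ)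
    (hmono : ∀ i j, i < j → j < r → a i < a j) :
    ((∃ i, 1 ≤ i ∧ i ≤ r - 2 ∧ Irrational ((a i - a 0) / (a (r - 1) - a 0))) →
      IV {y : ℝ | ∃ i, i < r ∧ y = a i} (a 0) (a (r - 1)) = ∅) ∧
    (∀ p q : ℕ → ℕ,
      (∀ i, 1 ≤ i → i ≤ r - 2 →
        0 < p i ∧ 0 < q i ∧ Nat.Coprime (p i) (q i) ∧
          (a i - a 0) / (a (r - 1) - a 0) = (p i : ℝ) / q i) →
      IV {y : ℝ | ∃ i, i < r ∧ y = a i} (a 0) (a (r - 1)) =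
        {y : ℝ | ∃ t : ℕ, 1 ≤ t ∧
          y = (1 / ((((Finset.Icc 1 (r - 2)).lcm q : ℕ) : ℝ) * t)) * a 0 +
              (1 - 1 / ((((Finset.Icc 1 (r - 2)).lcm q : ℕ) : ℝ) * t)) * a (r - 1)}) := by
  set b := a (r - 1) with hb
  set A : Set ℝ := {y : ℝ | ∃ i, i < r ∧ y = a i}
  have hab : 0 < b - a 0 := sub_pos.2 (hmono 0 (r - 1) (by omega) (by omega))
  have haA : a 0 ∈ A := ⟨0, by omega, rfl⟩
  have hbA : b ∈ A := ⟨r - 1, by omega, rfl⟩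
  refine ⟨?_, fun p q hpq => ?_⟩
  · rintro ⟨i, hi1, hi2, hirr⟩
    refine Set.eq_empty_of_forall_notMem fun P hP => ?_
    obtain ⟨N, hN1, -, hN⟩ := exists_denominator_of_mem_IV hP haA hbA
    obtain ⟨z, hz⟩ := hN (a i) ⟨i, by omega, rfl⟩
    exact (hirr.natCast_mul (by omega : N ≠ 0)).ne_int z hz
  · set M := (Finset.Icc 1 (r - 2)).lcm q with hM
    have hqM : ∀ i, 1 ≤ i → i ≤ r - 2 → q i ∣ M := fun i h1 h2 =>
      Finset.dvd_lcm (Finset.mem_Icc.2 ⟨h1, h2⟩)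
    have hM0 : M ≠ 0 := by
      rw [hM, Ne, Finset.lcm_eq_zero_iff]
      rintro ⟨i, hi, hi0⟩
      have hi := Finset.mem_Icc.1 hi
      have := (hpq i hi.1 hi.2).2.1
      omega
    have hplt : ∀ i, 1 ≤ i → i ≤ r - 2 → p i < q i := by
      intro i h1 h2
      obtain ⟨-, hq, -, hμ⟩ := hpq i h1 h2
      have hlt : (a i - a 0) / (b - a 0) < 1 := by
        rw [div_lt_one hab]
        linarith [hmono i (r - 1) (by omega) (by omega)]
      rw [hμ, div_lt_one (by exact_mod_cast hq)] at hlt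
      exact_mod_cast hlt
    have hM2 : 2 ≤ M := by
      have h1 := Nat.le_of_dvd (by omega) (hqM 1 le_rfl (by omega))
      have h2 := hplt 1 le_rfl (by omega)
      have h3 := (hpq 1 le_rfl (by omega)).1
      omega
    ext P
    constructor
    · intro hP
      obtain ⟨N, hN1, hNP, hN⟩ := exists_denominator_of_mem_IV hP haA hbA
      have hMN : M ∣ N := by
        refine Finset.lcm_dvd fun i hi => ?_
        obtain ⟨h1, h2⟩ := Finset.mem_Icc.1 hi
        obtain ⟨-, hq, hco, hμ⟩ := hpq i h1 h2
        obtain ⟨z, hz⟩ := hN (a i) ⟨i, by omega, rfl⟩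
        have hq' : (q i : ℝ) ≠ 0 := by exact_mod_cast hq.ne'
        rw [hμ, ← mul_div_assoc, div_eq_iff hq'] at hz
        have hz' : (N : ℤ) * p i = z * q i := by exact_mod_cast hz
        have hdvd : (q i : ℤ) ∣ ((N * p i : ℕ) : ℤ) := ⟨z, by push_cast; linarith⟩
        exact hco.symm.dvd_of_dvd_mul_right (Int.natCast_dvd_natCast.1 hdvd)
      obtain ⟨t, rfl⟩ := hMN
      refine ⟨t, Nat.one_le_iff_ne_zero.2 ?_, ?_⟩
      · rintro rfl
        omega
      · push_cast at hNP
        have hne : (M : ℝ) * t ≠ 0 := by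
          intro h
          rw [h] at hNP
          linarith
        have hδ : (M : ℝ) * t * (1 / ((M : ℝ) * t)) = 1 := mul_one_div_cancel hne
        apply mul_left_cancel₀ hne
        linear_combination (b - a 0) * hδ - hNP
    · rintro ⟨t, ht, rfl⟩
      have hMt : 1 < M * t := by nlinarith
      have hMt' : (1 : ℝ) < (M : ℝ) * t := by exact_mod_cast hMt
      have hpos : (0 : ℝ) < (M : ℝ) * t := by linarith
      have hinv : 0 < 1 / ((M : ℝ) * t) := by positivity
      have hinv1 : 1 / ((M : ℝ) * t) < 1 := (div_lt_one hpos).2 hMt'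
      refine mem_IV_of_lattice ⟨by nlinarith, by nlinarith⟩ ?_
      rintro _ ⟨i, hi, rfl⟩
      rcases Nat.eq_zero_or_pos i with rfl | hi0
      · refine ⟨M * t, ?_⟩
        push_cast
        field_simp
        ring
      rcases eq_or_ne i (r - 1) with rfl | hir
      · exact ⟨0, by simp [hb]⟩
      obtain ⟨c, hc⟩ := hqM i hi0 (by omega)
      obtain ⟨-, hq, -, hμ⟩ := hpq i hi0 (by omega)
      refine ⟨c * t * (q i - p i), ?_⟩
      have hq' : (q i : ℝ) ≠ 0 := by exact_mod_cast hq.ne'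
      have hc' : (M : ℝ) = q i * c := by exact_mod_cast hc
      rw [div_eq_div_iff hab.ne' hq'] at hμ
      have hδ : (M : ℝ) * t * (1 / ((M : ℝ) * t)) = 1 := mul_one_div_cancel hpos.ne'
      push_cast [(hplt i hi0 (by omega)).le]
      generalize 1 / ((M : ℝ) * t) = e at hδ ⊢
      rw [hc'] at hδ
      apply mul_left_cancel₀ hq'
      linear_combination hμ + (q i - p i : ℝ) * (b - a 0) * hδ
end

section
/- For real numbers a < b, DV(a,b) = { (k/(k+1))·a + (1/(k+1))·b : k ∈ ℕ, k ≥ 1 }. -/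
/-- `DV A a b` : the set of values `P ∈ (a,b)` such that for every sequence with terms in `A`,
the consecutive averages cannot pass from above `P` to below `P` without hitting `P`
at an intermediate index. -/
def DV (A : Set ℝ) (a b : ℝ) : Set ℝ :=
  {P | P ∈ Set.Ioo a b ∧ ∀ x : ℕ → ℝ, (∀ n, x n ∈ A) →
    ∀ k l : ℕ, 1 ≤ k → k < l → P < avgSeq x k → avgSeq x l < P →
      ∃ s : ℕ, k < s ∧ s < l ∧ avgSeq x s = P}

theorem avgSeq_sub_eq_of_lattice {x : ℕ → ℝ} {e : ℕ → ℤ} {P u : ℝ}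
    (h : ∀ i, x i - P = e i * u) {n : ℕ} (hn : 1 ≤ n) :
    avgSeq x n - P = ((∑ i ∈ Finset.range n, e i : ℤ) : ℝ) * (u / n) := by
  have hn' : (n : ℝ) ≠ 0 := by positivity
  have hsum : ∑ i ∈ Finset.range n, x i - n * P
      = ((∑ i ∈ Finset.range n, e i : ℤ) : ℝ) * u := by
    push_cast
    rw [Finset.sum_mul, ← Finset.sum_congr rfl fun i _ => h i]
    simp
  rw [← mul_div_assoc, ← hsum, avgSeq]
  field_simp

/-- An integer sequence that decreases by at most one at each step
cannot pass from positive to negative values without vanishing. -/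
theorem exists_eq_zero_of_sub_one_le {z : ℕ → ℤ} (hz : ∀ n, z n - 1 ≤ z (n + 1)) {k l : ℕ}
    (hkl : k < l) (hk : 0 < z k) (hl : z l < 0) : ∃ s, k < s ∧ s < l ∧ z s = 0 := by
  by_contra! hne
  have hpos : ∀ n, k ≤ n → n < l → 0 < z n := by
    intro n hn
    induction n, hn using Nat.le_induction with
    | base => exact fun _ => hk
    | succ n hn ih =>
      intro hnl
      have h1 := ih (by omega)
      have h2 := hz n
      have h3 := hne (n + 1) (by omega) hnl
      omega
  obtain ⟨m, rfl⟩ : ∃ m, l = m + 1 := ⟨l - 1, by omega⟩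
  have h1 := hpos m (by omega) (by omega)
  have h2 := hz m
  omega

theorem avgSeq_single_add_one (a b : ℝ) (j : ℕ) :
    avgSeq (fun n => if n = 0 then b else a) (j + 1) = (j * a + b) / (j + 1) := by
  simp [avgSeq, Finset.sum_range_succ']

/-- THEOREM 9: for `a < b`, `DV(a,b) = { (k/(k+1))·a + (1/(k+1))·b : k ≥ 1 }`. -/
theorem DV_pair (a b : ℝ) (hab : a < b) :
    DV ({a, b} : Set ℝ) a b =
      {y : ℝ | ∃ k : ℕ, 1 ≤ k ∧ y = ((k : ℝ) / (k + 1)) * a + (1 / ((k : ℝ) + 1)) * b} := by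
  ext P
  constructor
  · rintro ⟨⟨haP, hPb⟩, h⟩
    obtain ⟨j, hj⟩ := exists_nat_gt ((b - P) / (P - a))
    have hu : 0 < P - a := sub_pos.2 haP
    have hj' : b - P < j * (P - a) := (div_lt_iff₀ hu).1 hj
    have hj0 : 1 ≤ j := by
      rcases Nat.eq_zero_or_pos j with rfl | h0
      · norm_num at hj'
        linarith
      · exact h0
    obtain ⟨s, hs, -, hsP⟩ := h (fun n => if n = 0 then b else a)
      (fun n => by by_cases hn : n = 0 <;> simp [hn]) 1 (j + 1) le_rfl (by omega)
      (by simpa [avgSeq] using hPb)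
      (by
        rw [avgSeq_single_add_one, div_lt_iff₀ (by positivity)]
        linarith)
    obtain ⟨m, rfl⟩ : ∃ m, s = m + 1 := ⟨s - 1, by omega⟩
    refine ⟨m, by omega, ?_⟩
    rw [← hsP, avgSeq_single_add_one]
    ring
  · rintro ⟨k, hk, rfl⟩
    have hk1 : (0 : ℝ) < k + 1 := by positivity
    have hk0 : (0 : ℝ) < k := by exact_mod_cast hk
    have hba : 0 < b - a := sub_pos.2 hab
    have hu : 0 < (b - a) / (k + 1) := by positivity
    set P := (k : ℝ) / (k + 1) * a + 1 / ((k : ℝ) + 1) * b with hP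
    have hPa : a - P = -1 * ((b - a) / (k + 1)) := by
      rw [hP]; field_simp; ring
    have hPb : b - P = k * ((b - a) / (k + 1)) := by
      rw [hP]; field_simp; ring
    refine ⟨⟨by linarith, by linarith [mul_pos hk0 hu]⟩, ?_⟩
    intro x hx m l hm hml hPm hlP
    have he : ∀ i, x i - P = ((if x i = a then -1 else (k : ℤ) : ℤ) : ℝ) * ((b - a) / (k + 1)) := by
      intro i
      rcases hx i with hi | hi
      · simpa [hi] using hPa
      · rw [Set.mem_singleton_iff] at hi
        simpa [hi, hab.ne'] using hPb
    have havg := fun {n : ℕ} (hn : 1 ≤ n) => avgSeq_sub_eq_of_lattice he hn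
    have hdiv : ∀ {n : ℕ}, 1 ≤ n → 0 < (b - a) / (k + 1) / n :=
      fun hn => div_pos hu (by exact_mod_cast hn)
    obtain ⟨s, hms, hsl, hs⟩ := exists_eq_zero_of_sub_one_le
      (z := fun n => ∑ i ∈ Finset.range n, if x i = a then -1 else (k : ℤ))
      (fun n => by
        simp only [Finset.sum_range_succ]
        split_ifs <;> omega) hml
      (by
        have h := sub_pos.2 hPm
        rw [havg hm] at h
        exact_mod_cast pos_of_mul_pos_left h (hdiv hm).le)
      (by
        have h := sub_neg.2 hlP
        rw [havg (by omega)] at h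
        exact_mod_cast neg_of_mul_neg_left h (hdiv (n := l) (by omega)).le)
    refine ⟨s, hms, hsl, sub_eq_zero.1 ?_⟩
    rw [havg (by omega), hs]
    simp
end
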